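/- arXiv:2511.21791 — 2 statements merged into one kernel-verified Lean document; each statement's English description precedes it below -/
import Mathlib

section
/- Let S be a finite thick generalized quadrangle, let r be a prime, and let u, v be two noncollinear points such that r divides both |Ẽ(u)| and |Ẽ(v)|. Then v lies in the orbit of u under the action of the subgroup ⟨Ẽ(u), Ẽ(v)⟩ of the automorphism group on the points of S. -/
open Equiv

section GQDefs

variable {P L : Type*}

/-- A generalized quadrangle of order `(s,t)`: every line has `s+1` points, every point is
on `t+1` lines, two distinct points are on at most one common line, and for every
non-incident point-line pair `(p, ℓ)` there is a unique pair `(q, M)` with `M` a line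
through `p` and `q` a point incident with both `M` and `ℓ`. -/
structure IsGQ (I : P → L → Prop) (s t : ℕ) : Prop where
  point_count : ∀ ℓ : L, Nat.card {p : P // I p ℓ} = s + 1
  line_count : ∀ p : P, Nat.card {ℓ : L // I p ℓ} = t + 1
  unique_line : ∀ ⦃p q : P⦄, p ≠ q → ∀ ⦃ℓ m : L⦄, I p ℓ → I q ℓ → I p m → I q m → ℓ = m
  quad : ∀ ⦃p : P⦄ ⦃ℓ : L⦄, ¬ I p ℓ →
    ∃! qM : P × L, I p qM.2 ∧ I qM.1 qM.2 ∧ I qM.1 ℓ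

/-- Two points are collinear if some line is incident with both. -/
def Coll (I : P → L → Prop) (x y : P) : Prop := ∃ ℓ : L, I x ℓ ∧ I y ℓ

/-- The automorphism group of an incidence structure, as a subgroup of
`Perm P × Perm L`: pairs of permutations preserving incidence. -/
def autGroup (I : P → L → Prop) : Subgroup (Perm P × Perm L) where
  carrier := {g | ∀ p ℓ, I (g.1 p) (g.2 ℓ) ↔ I p ℓ}
  one_mem' := fun _ _ => Iff.rfl
  mul_mem' := fun {a b} ha hb p ℓ => (ha (b.1 p) (b.2 ℓ)).trans (hb p ℓ)
  inv_mem' := by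
    intro a ha p ℓ
    have h := ha (a⁻¹.1 p) (a⁻¹.2 ℓ)
    simpa using h.symm

/-- The full group `Ẽ(p)` of symmetries with center `p`: automorphisms fixing every
point collinear with `p`. -/
def symmGroup (I : P → L → Prop) (p : P) : Subgroup (Perm P × Perm L) where
  carrier := {g | g ∈ autGroup I ∧ ∀ y : P, Coll I p y → g.1 y = y}
  one_mem' := ⟨(autGroup I).one_mem, fun _ _ => rfl⟩
  mul_mem' := by
    rintro a b ⟨ha, ha'⟩ ⟨hb, hb'⟩
    refine ⟨(autGroup I).mul_mem ha hb, fun y hy => ?_⟩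
    have : (a * b).1 y = a.1 (b.1 y) := rfl
    rw [this, hb' y hy, ha' y hy]
  inv_mem' := by
    rintro a ⟨ha, ha'⟩
    refine ⟨(autGroup I).inv_mem ha, fun y hy => ?_⟩
    have h : a⁻¹.1 (a.1 y) = y := by simp
    rw [ha' y hy] at h
    exact h

/-- `x^⊥`: the set of points collinear with `x` (including `x` itself). -/
def perpSet (I : P → L → Prop) (x : P) : Set P := {y | Coll I x y}

/-- The hyperbolic line `{x,y}^{⊥⊥}`: points collinear with every point of
`{x,y}^⊥ = x^⊥ ∩ y^⊥`. -/
def hypLine (I : P → L → Prop) (x y : P) : Set P :=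
  {z | ∀ w ∈ perpSet I x ∩ perpSet I y, Coll I z w}

/-- The group `G` generated by all the point-symmetries of the quadrangle. -/
def bigGroup (I : P → L → Prop) : Subgroup (Perm P × Perm L) :=
  ⨆ x : P, symmGroup I x

/-- The set `P_r` of `r`-points: points whose full group of symmetries has order
divisible by `r`. -/
def Pr (I : P → L → Prop) (r : ℕ) : Set P :=
  {y | r ∣ Nat.card (symmGroup I y)}

/-- The set `L_r` of lines incident with at least two points of `P_r`. -/
def Lr (I : P → L → Prop) (r : ℕ) : Set L :=
  {ℓ | ∃ x y : P, x ≠ y ∧ x ∈ Pr I r ∧ y ∈ Pr I r ∧ I x ℓ ∧ I y ℓ}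

/-- The stabilizer `G_u` of a point `u` in a group `G` of automorphisms. -/
def stabPt (G : Subgroup (Perm P × Perm L)) (u : P) : Subgroup (Perm P × Perm L) where
  carrier := {g | g ∈ G ∧ g.1 u = u}
  one_mem' := ⟨G.one_mem, rfl⟩
  mul_mem' := by
    rintro a b ⟨ha, ha'⟩ ⟨hb, hb'⟩
    refine ⟨G.mul_mem ha hb, ?_⟩
    have : (a * b).1 u = a.1 (b.1 u) := rfl
    rw [this, hb', ha']
  inv_mem' := by
    rintro a ⟨ha, ha'⟩
    refine ⟨G.inv_mem ha, ?_⟩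
    have h : a⁻¹.1 (a.1 u) = u := by simp
    rw [ha'] at h
    exact h

/-- The setwise stabilizer `G_ℓ` of a line `ℓ` in a group `G` of automorphisms. -/
def stabLine (G : Subgroup (Perm P × Perm L)) (ℓ : L) : Subgroup (Perm P × Perm L) where
  carrier := {g | g ∈ G ∧ g.2 ℓ = ℓ}
  one_mem' := ⟨G.one_mem, rfl⟩
  mul_mem' := by
    rintro a b ⟨ha, ha'⟩ ⟨hb, hb'⟩
    refine ⟨G.mul_mem ha hb, ?_⟩
    have : (a * b).2 ℓ = a.2 (b.2 ℓ) := rfl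
    rw [this, hb', ha']
  inv_mem' := by
    rintro a ⟨ha, ha'⟩
    refine ⟨G.inv_mem ha, ?_⟩
    have h : a⁻¹.2 (a.2 ℓ) = ℓ := by simp
    rw [ha'] at h
    exact h

/-- Isomorphism of incidence structures: a pair of bijections between the point sets and
the line sets preserving incidence in both directions. -/
def IsoTo {P L P' L' : Type*} (I : P → L → Prop) (I' : P' → L' → Prop) : Prop :=
  ∃ (e : P ≃ P') (f : L ≃ L'), ∀ p ℓ, I' (e p) (f ℓ) ↔ I p ℓ

end GQDefs

section ClassicalGQs

/-- The standard nondegenerate alternating bilinear form on `F^4`. -/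
def sympForm {F : Type*} [Field F] (x y : Fin 4 → F) : F :=
  x 0 * y 1 - x 1 * y 0 + x 2 * y 3 - x 3 * y 2

/-- Points of `W(3,q)`: the `1`-dimensional subspaces of `F_q^4`. -/
def W3Point (F : Type*) [Field F] : Type _ :=
  {W : Submodule F (Fin 4 → F) // Module.finrank F W = 1}

/-- Lines of `W(3,q)`: the `2`-dimensional totally isotropic subspaces of `F_q^4` with
respect to a nondegenerate alternating form. -/
def W3Line (F : Type*) [Field F] : Type _ :=
  {U : Submodule F (Fin 4 → F) //
    Module.finrank F U = 2 ∧ ∀ x ∈ U, ∀ y ∈ U, sympForm x y = 0}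

/-- Incidence in `W(3,q)` is given by inclusion. -/
def W3Incid (F : Type*) [Field F] : W3Point F → W3Line F → Prop :=
  fun W U => W.1 ≤ U.1

/-- The standard nondegenerate Hermitian sesquilinear form on `F_{q²}^4`, relative to the
field automorphism `x ↦ x^q`. -/
def hermForm3 {F : Type*} [Field F] (q : ℕ) (x y : Fin 4 → F) : F :=
  x 0 * y 1 ^ q + x 1 * y 0 ^ q + x 2 * y 3 ^ q + x 3 * y 2 ^ q

/-- The standard nondegenerate Hermitian sesquilinear form on `F_{q²}^5`, relative to the
field automorphism `x ↦ x^q`. -/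
def hermForm4 {F : Type*} [Field F] (q : ℕ) (x y : Fin 5 → F) : F :=
  x 0 * y 1 ^ q + x 1 * y 0 ^ q + x 2 * y 3 ^ q + x 3 * y 2 ^ q + x 4 * y 4 ^ q

/-- Points of `H(3,q²)`: the `1`-dimensional isotropic subspaces of `F_{q²}^4`. -/
def H3Point (F : Type*) [Field F] (q : ℕ) : Type _ :=
  {W : Submodule F (Fin 4 → F) //
    Module.finrank F W = 1 ∧ ∀ x ∈ W, hermForm3 q x x = 0}

/-- Lines of `H(3,q²)`: the `2`-dimensional totally isotropic subspaces of `F_{q²}^4`. -/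
def H3Line (F : Type*) [Field F] (q : ℕ) : Type _ :=
  {U : Submodule F (Fin 4 → F) //
    Module.finrank F U = 2 ∧ ∀ x ∈ U, ∀ y ∈ U, hermForm3 q x y = 0}

/-- Incidence in `H(3,q²)` is given by inclusion. -/
def H3Incid (F : Type*) [Field F] (q : ℕ) : H3Point F q → H3Line F q → Prop :=
  fun W U => W.1 ≤ U.1

/-- Points of `H(4,q²)`: the `1`-dimensional isotropic subspaces of `F_{q²}^5`. -/
def H4Point (F : Type*) [Field F] (q : ℕ) : Type _ :=
  {W : Submodule F (Fin 5 → F) //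
    Module.finrank F W = 1 ∧ ∀ x ∈ W, hermForm4 q x x = 0}

/-- Lines of `H(4,q²)`: the `2`-dimensional totally isotropic subspaces of `F_{q²}^5`. -/
def H4Line (F : Type*) [Field F] (q : ℕ) : Type _ :=
  {U : Submodule F (Fin 5 → F) //
    Module.finrank F U = 2 ∧ ∀ x ∈ U, ∀ y ∈ U, hermForm4 q x y = 0}

/-- Incidence in `H(4,q²)` is given by inclusion. -/
def H4Incid (F : Type*) [Field F] (q : ℕ) : H4Point F q → H4Line F q → Prop :=
  fun W U => W.1 ≤ U.1

end ClassicalGQs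

section Symmetries

variable {P L : Type*} {I : P → L → Prop} {s t : ℕ}

theorem Coll.symm {x y : P} (h : Coll I x y) : Coll I y x :=
  let ⟨ℓ, hx, hy⟩ := h
  ⟨ℓ, hy, hx⟩

/-- A generalized quadrangle contains no triangles. -/
theorem IsGQ.incid_of_coll_of_coll (hGQ : IsGQ I s t) {x y z : P} {ℓ : L} (hx : I x ℓ)
    (hy : I y ℓ) (hxy : x ≠ y) (hzx : Coll I z x) (hzy : Coll I z y) : I z ℓ := by
  by_contra hz
  obtain ⟨m, hzm, hxm⟩ := hzx
  obtain ⟨n, hzn, hyn⟩ := hzy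
  have h := (hGQ.quad hz).unique (y₁ := (x, m)) (y₂ := (y, n)) ⟨hzm, hxm, hx⟩ ⟨hzn, hyn, hy⟩
  exact hxy (congrArg Prod.fst h)

theorem IsGQ.exists_incid_ne_ne (hGQ : IsGQ I s t) (hs : 2 ≤ s) (ℓ : L) (a b : P) :
    ∃ x, I x ℓ ∧ x ≠ a ∧ x ≠ b := by
  have hcard : {p : P | I p ℓ}.ncard = s + 1 := hGQ.point_count ℓ
  have hlt : ({a, b} : Set P).ncard < {p : P | I p ℓ}.ncard := by
    have := Set.ncard_insert_le a {b}
    rw [Set.ncard_singleton] at this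
    omega
  obtain ⟨x, hx, hx'⟩ := Set.exists_mem_notMem_of_ncard_lt_ncard hlt
  exact ⟨x, hx, fun h => hx' (by simp [h]), fun h => hx' (by simp [h])⟩

theorem IsGQ.exists_incid_line_ne (hGQ : IsGQ I s t) (ht : 2 ≤ t) (p : P) (m : L) :
    ∃ ℓ, I p ℓ ∧ ℓ ≠ m := by
  have hcard : {ℓ : L | I p ℓ}.ncard = t + 1 := hGQ.line_count p
  have hlt : ({m} : Set L).ncard < {ℓ : L | I p ℓ}.ncard := by
    rw [Set.ncard_singleton]
    omega
  obtain ⟨ℓ, hℓ, hℓ'⟩ := Set.exists_mem_notMem_of_ncard_lt_ncard hlt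
  exact ⟨ℓ, hℓ, hℓ'⟩

theorem IsGQ.exists_incid_line (hGQ : IsGQ I s t) (p : P) : ∃ ℓ, I p ℓ := by
  have hpos : 0 < Nat.card {ℓ : L // I p ℓ} := by
    rw [hGQ.line_count]
    omega
  obtain ⟨ℓ⟩ := (Nat.card_pos_iff.mp hpos).1
  exact ⟨ℓ.1, ℓ.2⟩

theorem IsGQ.exists_coll_incid (hGQ : IsGQ I s t) (p : P) (ℓ : L) :
    ∃ q, I q ℓ ∧ Coll I p q := by
  by_cases hp : I p ℓ
  · exact ⟨p, hp, ℓ, hp, hp⟩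
  · obtain ⟨⟨q, m⟩, ⟨hpm, hqm, hq⟩, -⟩ := hGQ.quad hp
    exact ⟨q, hq, m, hpm, hqm⟩

theorem Coll.map {g : Perm P × Perm L} (hg : g ∈ autGroup I) {x y : P} (h : Coll I x y) :
    Coll I (g.1 x) (g.1 y) :=
  let ⟨ℓ, hx, hy⟩ := h
  ⟨g.2 ℓ, (hg x ℓ).2 hx, (hg y ℓ).2 hy⟩

theorem IsGQ.line_fixed (hGQ : IsGQ I s t) {g : Perm P × Perm L} (hg : g ∈ autGroup I)
    {x y : P} {ℓ : L} (hxy : x ≠ y) (hx : I x ℓ) (hy : I y ℓ) (hgx : g.1 x = x)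
    (hgy : g.1 y = y) : g.2 ℓ = ℓ := by
  have hx' := (hg x ℓ).2 hx
  have hy' := (hg y ℓ).2 hy
  rw [hgx] at hx'
  rw [hgy] at hy'
  exact hGQ.unique_line hxy hx' hy' hx hy

/-- If a symmetry with center `u` fixes a point `p` not collinear with `u`, then it fixes every
point collinear with `p`. -/
theorem IsGQ.symm_fixed_of_coll (hGQ : IsGQ I s t) (ht : 2 ≤ t) {u p x : P}
    {g : Perm P × Perm L} (hg : g ∈ symmGroup I u) (hup : ¬ Coll I u p) (hgp : g.1 p = p)
    (hpx : Coll I p x) : g.1 x = x := by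
  obtain ⟨m, hpm, hxm⟩ := hpx
  have hum : ¬ I u m := fun h => hup ⟨m, h, hpm⟩
  obtain ⟨a, ham, hua⟩ := hGQ.exists_coll_incid u m
  have hpa : p ≠ a := by
    rintro rfl
    exact hup hua
  have hgm := hGQ.line_fixed hg.1 hpa hpm ham hgp (hg.2 a hua)
  have hgxm : I (g.1 x) m := by
    have h := (hg.1 x m).2 hxm
    rwa [hgm] at h
  obtain ⟨k₀, huk₀, hak₀⟩ := id hua
  obtain ⟨k, huk, hk⟩ := hGQ.exists_incid_line_ne ht u k₀
  obtain ⟨y, hyk, hxy⟩ := hGQ.exists_coll_incid x k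
  have hym : ¬ I y m := by
    intro hym
    have hya : y = a := by
      by_contra hya
      exact hum (hGQ.incid_of_coll_of_coll hym ham hya ⟨k, huk, hyk⟩ hua)
    subst hya
    have huy : u ≠ y := by
      rintro rfl
      exact hum hym
    exact hk (hGQ.unique_line huy huk hyk huk₀ hak₀)
  have hgxy := hxy.map hg.1
  rw [hg.2 y ⟨k, huk, hyk⟩] at hgxy
  by_contra hgx
  exact hym (hGQ.incid_of_coll_of_coll hgxm hxm hgx hgxy.symm hxy.symm)

/-- A symmetry with center `u` that fixes a point not collinear with `u` is trivial. -/
theorem IsGQ.symm_eq_one (hGQ : IsGQ I s t) (hs : 2 ≤ s) (ht : 2 ≤ t) {u p : P}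
    {g : Perm P × Perm L} (hg : g ∈ symmGroup I u) (hup : ¬ Coll I u p) (hgp : g.1 p = p) :
    g = 1 := by
  have hpt : ∀ z, g.1 z = z := by
    intro z
    by_cases huz : Coll I u z
    · exact hg.2 z huz
    obtain ⟨n, hzn⟩ := hGQ.exists_incid_line z
    have hfix : ∀ b, I b n → ¬ Coll I u b → g.1 b = b → g.1 z = z := fun b hbn hub hgb =>
      hGQ.symm_fixed_of_coll ht hg hub hgb ⟨n, hbn, hzn⟩
    obtain ⟨a, han, hpa⟩ := hGQ.exists_coll_incid p n
    by_cases hua : Coll I u a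
    · -- replace `p` by a collinear point whose projection to `n` is not collinear with `u`
      obtain ⟨m₀, hpm₀, ham₀⟩ := id hpa
      obtain ⟨m, hpm, hm⟩ := hGQ.exists_incid_line_ne ht p m₀
      obtain ⟨c, hcm, huc⟩ := hGQ.exists_coll_incid u m
      obtain ⟨w, hwm, hwp, hwc⟩ := hGQ.exists_incid_ne_ne hs m p c
      have huw : ¬ Coll I u w := fun h =>
        hup ⟨m, hGQ.incid_of_coll_of_coll hwm hcm hwc h huc, hpm⟩
      have hgw := hGQ.symm_fixed_of_coll ht hg hup hgp ⟨m, hpm, hwm⟩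
      obtain ⟨b, hbn, hwb⟩ := hGQ.exists_coll_incid w n
      have hpne : p ≠ a := by
        rintro rfl
        exact hup hua
      have hba : b ≠ a := by
        rintro rfl
        have hbm := hGQ.incid_of_coll_of_coll hwm hpm hwp hwb.symm hpa.symm
        exact hm (hGQ.unique_line hpne hpm hbm hpm₀ ham₀)
      refine hfix b hbn (fun hub => huz ⟨n, ?_, hzn⟩)
        (hGQ.symm_fixed_of_coll ht hg huw hgw hwb)
      exact hGQ.incid_of_coll_of_coll hbn han hba hub hua
    · exact hfix a han hua (hGQ.symm_fixed_of_coll ht hg hup hgp hpa)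
  refine Prod.ext (Equiv.ext hpt) (Equiv.ext fun ℓ => ?_)
  obtain ⟨x, hx, -, -⟩ := hGQ.exists_incid_ne_ne hs ℓ p p
  obtain ⟨y, hy, hyx, -⟩ := hGQ.exists_incid_ne_ne hs ℓ x x
  exact hGQ.line_fixed hg.1 hyx hy hx (hpt y) (hpt x)

/-- A point of the hyperbolic line `{u,v}^{⊥⊥}` collinear with `u` equals `u`. -/
theorem IsGQ.eq_of_mem_hypLine (hGQ : IsGQ I s t) (ht : 2 ≤ t) {u v x : P}
    (huv : ¬ Coll I u v) (hx : x ∈ hypLine I u v) (hux : Coll I u x) : x = u := by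
  obtain ⟨k, huk, hxk⟩ := hux
  obtain ⟨k', huk', hk'⟩ := hGQ.exists_incid_line_ne ht u k
  obtain ⟨w, hwk', hvw⟩ := hGQ.exists_coll_incid v k'
  have huw : u ≠ w := by
    rintro rfl
    exact huv hvw.symm
  by_contra hxu
  have hxw : Coll I x w := hx w ⟨⟨k', huk', hwk'⟩, hvw⟩
  have hxk' := hGQ.incid_of_coll_of_coll huk' hwk' huw ⟨k, hxk, huk⟩ hxw
  exact hk' (hGQ.unique_line hxu hxk' huk' hxk huk)

theorem hypLine_comm (u v : P) : hypLine I u v = hypLine I v u := by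
  simp only [hypLine, Set.inter_comm]

/-- The group generated by the symmetries with centers `u` and `v` maps `u` into the hyperbolic
line `{u,v}^{⊥⊥}`. -/
theorem apply_mem_hypLine {u v : P} {g : Perm P × Perm L}
    (hg : g ∈ symmGroup I u ⊔ symmGroup I v) : g.1 u ∈ hypLine I u v := by
  rintro w ⟨huw, hvw⟩
  have haut : symmGroup I u ⊔ symmGroup I v ≤ autGroup I :=
    sup_le (fun _ h => h.1) (fun _ h => h.1)
  have hfix : symmGroup I u ⊔ symmGroup I v ≤ stabPt ⊤ w :=
    sup_le (fun _ h => ⟨trivial, h.2 w huw⟩) (fun _ h => ⟨trivial, h.2 w hvw⟩)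
  have h := Coll.map (haut hg) huw
  rwa [(hfix hg).2] at h

/-- A permutation of order dividing a prime `r` that preserves a finite set has, modulo `r`, as
many fixed points in the set as the set has elements. -/
theorem ncard_modEq_ncard_fixed [Finite P] {r : ℕ} (hr : r.Prime) {f : Perm P} (hf : f ^ r = 1)
    {A : Set P} (hA : ∀ x ∈ A, f x ∈ A) : A.ncard ≡ {x ∈ A | f x = x}.ncard [MOD r] := by
  classical
  have : Fact r.Prime := ⟨hr⟩
  have := Fintype.ofFinite A
  let f' : Function.End A := fun x => ⟨f x, hA x x.2⟩
  have hpow : ∀ (n : ℕ) (x : A), ((f' ^ n) x : P) = (f ^ n) x := by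
    intro n
    induction n with
    | zero => exact fun _ => rfl
    | succ n ih =>
      intro x
      rw [pow_succ, pow_succ]
      exact ih (f' x)
  have hf' : f' ^ r ^ 1 = 1 := by
    funext x
    apply Subtype.ext
    rw [hpow, pow_one, hf]
    rfl
  have h := Equiv.Perm.card_fixedPoints_modEq hf'
  rw [← Nat.card_eq_fintype_card, ← Nat.card_eq_fintype_card] at h
  have hfixed : Nat.card (Function.fixedPoints f') = {x ∈ A | f x = x}.ncard := by
    refine Nat.card_congr
      ⟨fun x => ⟨x.1, x.1.2, congrArg Subtype.val x.2⟩,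
        fun x => ⟨⟨x.1, x.2.1⟩, Subtype.ext x.2.2⟩, fun _ => rfl, fun _ => rfl⟩
  rwa [hfixed] at h

/-- If `r` divides the order of the group of symmetries with center `u`, some symmetry of order
`r` fixes only points collinear with `u`. -/
theorem IsGQ.exists_symm_pow_eq_one [Finite P] [Finite L] (hGQ : IsGQ I s t) (hs : 2 ≤ s)
    (ht : 2 ≤ t) {r : ℕ} (hr : r.Prime) {u : P} (hu : r ∣ Nat.card (symmGroup I u)) :
    ∃ g ∈ symmGroup I u, g.1 ^ r = 1 ∧ ∀ x, g.1 x = x → Coll I u x := by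
  have : Fact r.Prime := ⟨hr⟩
  obtain ⟨g, hg⟩ := exists_prime_orderOf_dvd_card' r hu
  have hpow : (g : Perm P × Perm L) ^ r = 1 := by
    rw [← Subgroup.coe_pow, ← hg, pow_orderOf_eq_one, Subgroup.coe_one]
  refine ⟨g, g.2, congrArg Prod.fst hpow, fun x hx => ?_⟩
  by_contra hux
  have hg1 : g = 1 := Subtype.ext (hGQ.symm_eq_one hs ht g.2 hux hx)
  rw [hg1, orderOf_one] at hg
  exact hr.one_lt.ne hg

end Symmetries

/-- If `u, v` are noncollinear points and the prime `r` divides both `|Ẽ(u)|` and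
`|Ẽ(v)|`, then `v` lies in the `⟨Ẽ(u), Ẽ(v)⟩`-orbit of `u`. -/
theorem mem_orbit_of_symmGroups {P L : Type} [Finite P] [Finite L]
    (I : P → L → Prop) (s t : ℕ) (hGQ : IsGQ I s t) (hs : 2 ≤ s) (ht : 2 ≤ t)
    (r : ℕ) (hr : r.Prime) (u v : P) (huv : ¬ Coll I u v)
    (hu : r ∣ Nat.card (symmGroup I u)) (hv : r ∣ Nat.card (symmGroup I v)) :
    ∃ g ∈ symmGroup I u ⊔ symmGroup I v, g.1 u = v := by
  by_contra! hne
  let A : Set P := {x | ∃ g ∈ symmGroup I u ⊔ symmGroup I v, g.1 u = x}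
  have hmaps : ∀ g ∈ symmGroup I u ⊔ symmGroup I v, ∀ x ∈ A, g.1 x ∈ A := by
    rintro g hg _ ⟨h, hh, rfl⟩
    exact ⟨g * h, mul_mem hg hh, rfl⟩
  have hhyp : ∀ x ∈ A, x ∈ hypLine I u v := by
    rintro _ ⟨g, hg, rfl⟩
    exact apply_mem_hypLine hg
  obtain ⟨a, ha, har, hafix⟩ := hGQ.exists_symm_pow_eq_one hs ht hr hu
  obtain ⟨b, hb, hbr, hbfix⟩ := hGQ.exists_symm_pow_eq_one hs ht hr hv
  obtain ⟨ℓ, hℓ⟩ := hGQ.exists_incid_line u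
  have hA : {x ∈ A | a.1 x = x} = {u} := by
    ext x
    refine ⟨fun hx => hGQ.eq_of_mem_hypLine ht huv (hhyp x hx.1) (hafix x hx.2), ?_⟩
    rintro rfl
    exact ⟨⟨1, one_mem _, rfl⟩, ha.2 _ ⟨ℓ, hℓ, hℓ⟩⟩
  have hB : {x ∈ A | b.1 x = x} = ∅ := by
    refine Set.eq_empty_of_forall_notMem fun x hx => ?_
    have hxv : x = v := hGQ.eq_of_mem_hypLine ht (fun h => huv h.symm)
      (hypLine_comm (I := I) u v ▸ hhyp x hx.1) (hbfix x hx.2)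
    obtain ⟨g, hg, hgx⟩ := hx.1
    exact hne g hg (hgx.trans hxv)
  have h1 := ncard_modEq_ncard_fixed hr har (hmaps a (Subgroup.mem_sup_left ha))
  have h0 := ncard_modEq_ncard_fixed hr hbr (hmaps b (Subgroup.mem_sup_right hb))
  rw [hA, Set.ncard_singleton] at h1
  rw [hB, Set.ncard_empty] at h0
  have h10 : 1 ≡ 0 [MOD r] := h1.symm.trans h0
  exact hr.one_lt.ne' (Nat.dvd_one.mp ((Nat.modEq_zero_iff_dvd).mp h10))
end

section
/- Let S be a finite thick generalized quadrangle in which Ẽ(x) is nontrivial for every point x, let G = ⟨Ẽ(x) : x a point⟩, and let r be a prime with P_r = {y : r divides |Ẽ(y)|} nonempty. Then G acts transitively on P_r. Moreover, if L_r, the set of lines incident with at least two points of P_r, is nonempty, then G acts transitively on L_r, and for each line ℓ ∈ L_r the setwise stabilizer G_ℓ acts 2-transitively on the set of points of P_r incident with ℓ. -/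
open Equiv

section Collinearity

variable {P L : Type*} {I : P → L → Prop} {s t : ℕ}

namespace IsGQ

/-- A point collinear with two distinct points of a line lies on that line. -/
theorem incid_of_coll (h : IsGQ I s t) {a b z : P} {ℓ : L} (ha : I a ℓ) (hb : I b ℓ)
    (hab : a ≠ b) (hza : Coll I z a) (hzb : Coll I z b) : I z ℓ := by
  by_contra hz
  obtain ⟨M, hzM, haM⟩ := hza
  obtain ⟨N, hzN, hbN⟩ := hzb
  have := (h.quad hz).unique (y₁ := (a, M)) (y₂ := (b, N)) ⟨hzM, haM, ha⟩ ⟨hzN, hbN, hb⟩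
  exact hab (congrArg Prod.fst this)

theorem exists_coll_incid_s9 (h : IsGQ I s t) (p : P) (ℓ : L) : ∃ q, Coll I p q ∧ I q ℓ := by
  by_cases hp : I p ℓ
  · exact ⟨p, ⟨ℓ, hp, hp⟩, hp⟩
  · obtain ⟨⟨q, M⟩, ⟨h₁, h₂, h₃⟩, -⟩ := h.quad hp
    exact ⟨q, ⟨M, h₁, h₂⟩, h₃⟩

theorem exists_line_ne (h : IsGQ I s t) (ht : 2 ≤ t) (p : P) (ℓ : L) : ∃ m, I p m ∧ m ≠ ℓ := by
  have hcard : ({ℓ} : Set L).ncard < {m : L | I p m}.ncard := by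
    have h₁ : {m : L | I p m}.ncard = t + 1 := h.line_count p
    rw [Set.ncard_singleton]
    omega
  obtain ⟨m, hm, hm'⟩ := Set.exists_mem_notMem_of_ncard_lt_ncard hcard
  exact ⟨m, hm, hm'⟩

theorem exists_line (h : IsGQ I s t) (p : P) : ∃ m, I p m := by
  have : Nat.card {m : L // I p m} ≠ 0 := by rw [h.line_count]; omega
  obtain ⟨⟨m, hm⟩⟩ := (Nat.card_ne_zero.1 this).1
  exact ⟨m, hm⟩

theorem exists_point_ne_ne (h : IsGQ I s t) (hs : 2 ≤ s) (ℓ : L) (a b : P) :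
    ∃ c, I c ℓ ∧ c ≠ a ∧ c ≠ b := by
  have hcard : ({a, b} : Set P).ncard < {p : P | I p ℓ}.ncard := by
    have h₁ : {p : P | I p ℓ}.ncard = s + 1 := h.point_count ℓ
    have h₂ := Set.ncard_insert_le a {b}
    rw [Set.ncard_singleton] at h₂
    omega
  obtain ⟨c, hc, hc'⟩ := Set.exists_mem_notMem_of_ncard_lt_ncard hcard
  simp only [Set.mem_insert_iff, Set.mem_singleton_iff, not_or] at hc'
  exact ⟨c, hc, hc'⟩

theorem exists_not_coll (h : IsGQ I s t) (hs : 2 ≤ s) (ht : 2 ≤ t) (x : P) :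
    ∃ y, ¬ Coll I y x := by
  obtain ⟨N, hxN⟩ := h.exists_line x
  obtain ⟨a, haN, hax, -⟩ := h.exists_point_ne_ne hs N x x
  obtain ⟨M, haM, hMN⟩ := h.exists_line_ne ht a N
  obtain ⟨b, hbM, hba, -⟩ := h.exists_point_ne_ne hs M a a
  refine ⟨b, fun hb => hMN ?_⟩
  have hxM : I x M := h.incid_of_coll haM hbM hba.symm ⟨N, hxN, haN⟩ hb.symm
  exact h.unique_line hax haM hxM haN hxN

end IsGQ

end Collinearity

section Symmetries

variable {P L : Type*} {I : P → L → Prop} {s t : ℕ} {g : Perm P × Perm L}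

namespace IsGQ

theorem apply_line_eq (h : IsGQ I s t) (hg : g ∈ autGroup I) {a b : P} {ℓ m : L} (hab : a ≠ b)
    (ha : I a ℓ) (hb : I b ℓ) (ha' : I (g.1 a) m) (hb' : I (g.1 b) m) : g.2 ℓ = m :=
  h.unique_line (g.1.injective.ne hab) ((hg a ℓ).2 ha) ((hg b ℓ).2 hb) ha' hb'

/-- The fixed points of a symmetry with center `x` that are not collinear with `x` propagate
along lines. -/
theorem symm_fixes_of_coll (h : IsGQ I s t) (ht : 2 ≤ t) {x y z : P} (hg : g ∈ symmGroup I x)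
    (hy : ¬ Coll I x y) (hgy : g.1 y = y) (hz : ¬ Coll I x z) (hyz : Coll I y z) :
    g.1 z = z := by
  by_cases hne : z = y
  · rw [hne, hgy]
  obtain ⟨M, hyM, hzM⟩ := hyz
  obtain ⟨c, hxc, hcM⟩ := h.exists_coll_incid_s9 x M
  have hcy : c ≠ y := by rintro rfl; exact hy hxc
  have hgc := hg.2 c hxc
  have hgM : g.2 M = M :=
    h.apply_line_eq hg.1 hcy hcM hyM (by rwa [hgc]) (by rwa [hgy])
  have hgzM : I (g.1 z) M := hgM ▸ (hg.1 z M).2 hzM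
  obtain ⟨N, hzN, hNM⟩ := h.exists_line_ne ht z M
  obtain ⟨a, hxa, haN⟩ := h.exists_coll_incid_s9 x N
  have haz : a ≠ z := by rintro rfl; exact hz hxa
  have hga := hg.2 a hxa
  by_contra hgz
  have hagz : Coll I a (g.1 z) := by
    have := Coll.map hg.1 (⟨N, haN, hzN⟩ : Coll I a z)
    rwa [hga] at this
  have haM := h.incid_of_coll hzM hgzM (Ne.symm hgz) ⟨N, haN, hzN⟩ hagz
  exact hNM (h.unique_line haz haN hzN haM hzM)

/-- The group of symmetries with center `x` acts semiregularly on the points not collinear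
with `x`. -/
theorem symm_eq_one_s9 (h : IsGQ I s t) (hs : 2 ≤ s) (ht : 2 ≤ t) {x y : P}
    (hg : g ∈ symmGroup I x) (hy : ¬ Coll I x y) (hgy : g.1 y = y) : g = 1 := by
  have hfix : ∀ z, g.1 z = z := by
    intro z
    by_cases hz : Coll I x z
    · exact hg.2 z hz
    obtain ⟨M, hzM⟩ := h.exists_line z
    obtain ⟨c, hxc, hcM⟩ := h.exists_coll_incid_s9 x M
    have hcz : c ≠ z := by rintro rfl; exact hz hxc
    obtain ⟨w, hwM, hwz, hwc⟩ := h.exists_point_ne_ne hs M z c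
    have hxM : ¬ I x M := fun hxM => hz ⟨M, hxM, hzM⟩
    have hw : ¬ Coll I x w := fun hw => hxM (h.incid_of_coll hcM hwM hwc.symm hxc hw)
    obtain ⟨K, hwK, hKM⟩ := h.exists_line_ne ht w M
    obtain ⟨v, hyv, hvK⟩ := h.exists_coll_incid_s9 y K
    by_cases hv : Coll I x v
    · obtain ⟨N, hyN, hvN⟩ := hyv
      obtain ⟨v', hzv', hvN'⟩ := h.exists_coll_incid_s9 z N
      by_cases hv' : Coll I x v'
      · exfalso
        have hvv' : v = v' := by
          by_contra hne
          exact hy ⟨N, h.incid_of_coll hvN hvN' hne hv hv', hyN⟩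
        subst hvv'
        have hvM := h.incid_of_coll hzM hwM hwz.symm hzv'.symm ⟨K, hvK, hwK⟩
        have hvw : v ≠ w := by rintro rfl; exact hw hv
        exact hKM (h.unique_line hvw hvK hwK hvM hwM)
      · have hgv' := h.symm_fixes_of_coll ht hg hy hgy hv' ⟨N, hyN, hvN'⟩
        exact h.symm_fixes_of_coll ht hg hv' hgv' hz hzv'.symm
    · have hgv := h.symm_fixes_of_coll ht hg hy hgy hv hyv
      have hgw := h.symm_fixes_of_coll ht hg hv hgv hw ⟨K, hvK, hwK⟩
      exact h.symm_fixes_of_coll ht hg hw hgw hz ⟨M, hwM, hzM⟩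
  refine Prod.ext (Equiv.ext hfix) (Equiv.ext fun ℓ => ?_)
  obtain ⟨a, ha, -, -⟩ := h.exists_point_ne_ne hs ℓ x x
  obtain ⟨b, hb, hba, -⟩ := h.exists_point_ne_ne hs ℓ a a
  exact h.apply_line_eq hg.1 hba hb ha (by rwa [hfix]) (by rwa [hfix])

/-- A line fixed by a nontrivial symmetry passes through its center. -/
theorem center_incid_of_fixed_line (h : IsGQ I s t) (hs : 2 ≤ s) (ht : 2 ≤ t) {w : P} {ℓ : L}
    (hg : g ∈ symmGroup I w) (hg1 : g ≠ 1) (hℓ : g.2 ℓ = ℓ) : I w ℓ := by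
  by_contra hw
  obtain ⟨p, ⟨K, hwK, hpK⟩, hpℓ⟩ := h.exists_coll_incid_s9 w ℓ
  obtain ⟨N, hwN, hNK⟩ := h.exists_line_ne ht w K
  obtain ⟨q, hqℓ, hqp, -⟩ := h.exists_point_ne_ne hs ℓ p p
  have hwq : ¬ Coll I w q := fun hwq =>
    hw (h.incid_of_coll hpℓ hqℓ hqp.symm ⟨K, hwK, hpK⟩ hwq)
  obtain ⟨v, hqv, hvN⟩ := h.exists_coll_incid_s9 q N
  refine hg1 (h.symm_eq_one_s9 hs ht hg hwq ?_)
  by_contra hgq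
  have hgqℓ : I (g.1 q) ℓ := hℓ ▸ (hg.1 q ℓ).2 hqℓ
  have hvgq : Coll I v (g.1 q) := by
    have := Coll.map hg.1 hqv.symm
    rwa [hg.2 v ⟨N, hwN, hvN⟩] at this
  have hvℓ := h.incid_of_coll hqℓ hgqℓ (Ne.symm hgq) hqv.symm hvgq
  have hvp : v = p := by
    by_contra hne
    exact hw (h.incid_of_coll hvℓ hpℓ hne ⟨N, hwN, hvN⟩ ⟨K, hwK, hpK⟩)
  subst hvp
  have hwv : w ≠ v := by rintro rfl; exact hw hpℓ
  exact hNK (h.unique_line hwv hwN hvN hwK hpK)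

/-- A nontrivial symmetry maps no point not collinear with its center to a collinear point. -/
theorem not_coll_symm_apply (h : IsGQ I s t) (hs : 2 ≤ s) (ht : 2 ≤ t) {w x : P}
    (hg : g ∈ symmGroup I w) (hg1 : g ≠ 1) (hx : ¬ Coll I w x) : ¬ Coll I x (g.1 x) := by
  rintro ⟨ℓ, hxℓ, hgxℓ⟩
  obtain ⟨M, hxM, hMℓ⟩ := h.exists_line_ne ht x ℓ
  obtain ⟨a, hwa, haM⟩ := h.exists_coll_incid_s9 w M
  have hne : x ≠ g.1 x := fun hgx => hg1 (h.symm_eq_one_s9 hs ht hg hx hgx.symm)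
  have hagx : Coll I a (g.1 x) := by
    have := Coll.map hg.1 (⟨M, haM, hxM⟩ : Coll I a x)
    rwa [hg.2 a hwa] at this
  have haℓ := h.incid_of_coll hxℓ hgxℓ hne ⟨M, haM, hxM⟩ hagx
  have hax : a ≠ x := by rintro rfl; exact hx hwa
  exact hMℓ (h.unique_line hax haM hxM haℓ hxℓ)

/-- If every point is the center of a nontrivial symmetry, then there are no two nonempty
sets of points, both invariant under all symmetries, such that every point of one is
collinear with every point of the other. -/
theorem not_exists_invariant_coll_sets (h : IsGQ I s t) (hs : 2 ≤ s) (ht : 2 ≤ t)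
    (hE : ∀ x : P, symmGroup I x ≠ ⊥) {X Y : Set P} (hX : X.Nonempty) (hY : Y.Nonempty)
    (hXinv : ∀ w, ∀ g ∈ symmGroup I w, ∀ x ∈ X, g.1 x ∈ X)
    (hYinv : ∀ w, ∀ g ∈ symmGroup I w, ∀ y ∈ Y, g.1 y ∈ Y)
    (hcoll : ∀ x ∈ X, ∀ y ∈ Y, Coll I x y) : False := by
  have hpair : ∀ Z : Set P, Z.Nonempty → (∀ w, ∀ g ∈ symmGroup I w, ∀ z ∈ Z, g.1 z ∈ Z) →
      ∃ z ∈ Z, ∃ z' ∈ Z, ¬ Coll I z z' := by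
    rintro Z ⟨z, hz⟩ hinv
    obtain ⟨w, hw⟩ := h.exists_not_coll hs ht z
    obtain ⟨g, hg, hg1⟩ := (Subgroup.bot_or_exists_ne_one _).resolve_left (hE w)
    exact ⟨z, hz, g.1 z, hinv w g hg z hz, h.not_coll_symm_apply hs ht hg hg1 hw⟩
  have hsep : ∀ Z W : Set P, (∃ z ∈ Z, ∃ z' ∈ Z, ¬ Coll I z z') →
      (∀ z ∈ Z, ∀ w ∈ W, Coll I z w) → ∀ a ∈ W, ∀ b ∈ W, a ≠ b → ¬ Coll I a b := by
    rintro Z W ⟨z, hz, z', hz', hzz'⟩ hc a ha b hb hab ⟨ℓ, haℓ, hbℓ⟩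
    exact hzz' ⟨ℓ, h.incid_of_coll haℓ hbℓ hab (hc z hz a ha) (hc z hz b hb),
      h.incid_of_coll haℓ hbℓ hab (hc z' hz' a ha) (hc z' hz' b hb)⟩
  have hXsep := hsep Y X (hpair Y hY hYinv) fun y hy x hx => (hcoll x hx y hy).symm
  obtain ⟨x, hx⟩ := hX
  obtain ⟨y, hy⟩ := hY
  obtain ⟨ℓ, hxℓ, hyℓ⟩ := hcoll x hx y hy
  obtain ⟨u, huℓ, hux, huy⟩ := h.exists_point_ne_ne hs ℓ x y
  have hunique : ∀ m, I u m → ∀ x' ∈ X, I x' m → m = ℓ := by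
    intro m hum x' hx' hxm
    have hx'ℓ : I x' ℓ :=
      h.incid_of_coll huℓ hyℓ huy ⟨m, hxm, hum⟩ (hcoll x' hx' y hy)
    have hux' : u ≠ x' := by
      rintro rfl
      exact hXsep u hx' x hx hux ⟨ℓ, huℓ, hxℓ⟩
    exact h.unique_line hux' hum hxm huℓ hx'ℓ
  obtain ⟨M, huM, hMℓ⟩ := h.exists_line_ne ht u ℓ
  obtain ⟨w, hwM, hwu, -⟩ := h.exists_point_ne_ne hs M u u
  obtain ⟨g, hg, hg1⟩ := (Subgroup.bot_or_exists_ne_one _).resolve_left (hE w)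
  have hgu := hg.2 u ⟨M, hwM, huM⟩
  have hgℓ : g.2 ℓ = ℓ :=
    hunique _ (by simpa only [hgu] using (hg.1 u ℓ).2 huℓ) _ (hXinv w g hg x hx)
      ((hg.1 x ℓ).2 hxℓ)
  have hwℓ := h.center_incid_of_fixed_line hs ht hg hg1 hgℓ
  exact hMℓ (h.unique_line hwu hwM huM hwℓ huℓ)

end IsGQ

theorem symmGroup_le_bigGroup (I : P → L → Prop) (x : P) : symmGroup I x ≤ bigGroup I :=
  le_iSup (symmGroup I) x

theorem bigGroup_le_autGroup (I : P → L → Prop) : bigGroup I ≤ autGroup I :=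
  iSup_le fun _ _ hg => hg.1

theorem sup_symmGroup_le_stabPt {x y u : P} (hx : Coll I x u) (hy : Coll I y u) :
    symmGroup I x ⊔ symmGroup I y ≤ stabPt (autGroup I) u :=
  sup_le (fun _ hg => ⟨hg.1, hg.2 u hx⟩) fun _ hg => ⟨hg.1, hg.2 u hy⟩

theorem conj_mem_symmGroup (hg : g ∈ autGroup I) {x : P} {k : Perm P × Perm L}
    (hk : k ∈ symmGroup I x) : g * k * g⁻¹ ∈ symmGroup I (g.1 x) := by
  refine ⟨mul_mem (mul_mem hg hk.1) (inv_mem hg), fun y hy => ?_⟩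
  have hy' : Coll I x (g.1.symm y) := by simpa using Coll.map (inv_mem hg) hy
  change g.1 (k.1 (g.1.symm y)) = y
  rw [hk.2 _ hy', Equiv.apply_symm_apply]

/-- If `O` is invariant under an element of prime order `r`, then `|O|` is congruent modulo `r`
to the number of points of `O` fixed by it. -/
theorem ncard_modEq_ncard_fixed_s9 [Finite P] {r : ℕ} (hr : r.Prime) (hgr : orderOf g = r) {O : Set P}
    (hO : ∀ z, g.1 z ∈ O ↔ z ∈ O) :
    O.ncard ≡ {z | z ∈ O ∧ g.1 z = z}.ncard [MOD r] := by
  classical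
  have := Fact.mk hr
  have := Fintype.ofFinite P
  have hg : g.1 ^ r = 1 := by rw [← Prod.pow_fst, ← hgr, pow_orderOf_eq_one, Prod.fst_one]
  let f : Function.End O := MulAction.toEndHom (g.1.subtypePerm hO : Perm O)
  have hf : f ^ r ^ 1 = 1 := by
    have hpow : (g.1.subtypePerm hO : Perm O) ^ r = 1 := by
      ext z
      simp [Perm.subtypePerm_pow, hg]
    rw [pow_one, ← map_pow, hpow, map_one]
  have key := Equiv.Perm.card_fixedPoints_modEq hf
  simp only [Fintype.card_eq_nat_card] at key
  have hfix : {z | z ∈ O ∧ g.1 z = z}.ncard = Nat.card f.fixedPoints := Nat.card_congr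
    ⟨fun z => ⟨⟨z.1, z.2.1⟩, Subtype.ext z.2.2⟩,
    fun z => ⟨z.1.1, z.1.2, congrArg Subtype.val z.2⟩, fun _ => rfl, fun _ => rfl⟩
  rwa [hfix]

variable [Finite P] [Finite L] {r : ℕ}

theorem mem_Pr_iff (hr : r.Prime) {x : P} :
    x ∈ Pr I r ↔ ∃ k ∈ symmGroup I x, orderOf k = r := by
  have := Fact.mk hr
  constructor
  · intro hx
    obtain ⟨⟨k, hk⟩, hk'⟩ := exists_prime_orderOf_dvd_card' r hx
    exact ⟨k, hk, by rw [← hk', Subgroup.orderOf_mk]⟩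
  · rintro ⟨k, hk, rfl⟩
    exact Subgroup.orderOf_dvd_natCard _ hk

theorem apply_mem_Pr (hr : r.Prime) (hg : g ∈ autGroup I) {x : P} (hx : x ∈ Pr I r) :
    g.1 x ∈ Pr I r := by
  obtain ⟨k, hk, hk'⟩ := (mem_Pr_iff hr).1 hx
  refine (mem_Pr_iff hr).2 ⟨_, conj_mem_symmGroup hg hk, ?_⟩
  rw [← hk', ← MulAut.conj_apply, MulEquiv.orderOf_eq]

namespace IsGQ

/-- Two noncollinear points admitting symmetries of prime order `r` are conjugate under the
group generated by the symmetries centered at them. -/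
theorem exists_sup_apply_eq (h : IsGQ I s t) (hs : 2 ≤ s) (ht : 2 ≤ t) (hr : r.Prime) {x y : P}
    (hx : x ∈ Pr I r) (hy : y ∈ Pr I r) (hxy : ¬ Coll I x y) :
    ∃ k ∈ symmGroup I x ⊔ symmGroup I y, k.1 x = y := by
  by_contra! hcon
  obtain ⟨a, b, hxa, hya, hxb, hyb, hab⟩ : ∃ a b, Coll I x a ∧ Coll I y a ∧ Coll I x b ∧
      Coll I y b ∧ ¬ Coll I a b := by
    obtain ⟨M, hxM⟩ := h.exists_line x
    obtain ⟨N, hxN, hNM⟩ := h.exists_line_ne ht x M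
    obtain ⟨a, hya, haM⟩ := h.exists_coll_incid_s9 y M
    obtain ⟨b, hyb, hbN⟩ := h.exists_coll_incid_s9 y N
    refine ⟨a, b, ⟨M, hxM, haM⟩, hya, ⟨N, hxN, hbN⟩, hyb, ?_⟩
    rintro ⟨K, haK, hbK⟩
    have hxa : x ≠ a := by rintro rfl; exact hxy hya.symm
    by_cases hab : a = b
    · subst hab
      exact hNM (h.unique_line hxa hxN hbN hxM haM)
    · exact hxy ⟨K, h.incid_of_coll haK hbK hab ⟨M, hxM, haM⟩ ⟨N, hxN, hbN⟩,
        h.incid_of_coll haK hbK hab hya hyb⟩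
  have hsep : ∀ z z', Coll I z a → Coll I z b → Coll I z' a → Coll I z' b → z ≠ z' →
      ¬ Coll I z z' := by
    rintro z z' hza hzb hza' hzb' hne ⟨ℓ, hz, hz'⟩
    exact hab ⟨ℓ, h.incid_of_coll hz hz' hne hza.symm hza'.symm,
      h.incid_of_coll hz hz' hne hzb.symm hzb'.symm⟩
  set H := symmGroup I x ⊔ symmGroup I y
  let O : Set P := {z | ∃ k ∈ H, k.1 y = z}
  have hOinv : ∀ k ∈ H, ∀ z, k.1 z ∈ O ↔ z ∈ O := by
    refine fun k hk z => ⟨?_, ?_⟩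
    · rintro ⟨m, hm, hmz⟩
      refine ⟨k⁻¹ * m, mul_mem (inv_mem hk) hm, ?_⟩
      change k.1.symm (m.1 y) = z
      rw [hmz, Equiv.symm_apply_apply]
    · rintro ⟨m, hm, rfl⟩
      exact ⟨k * m, mul_mem hk hm, rfl⟩
  have hyO : y ∈ O := ⟨1, one_mem _, rfl⟩
  have hxO : x ∉ O := by
    rintro ⟨k, hk, hkx⟩
    refine hcon k⁻¹ (inv_mem hk) ?_
    change k.1.symm x = y
    rw [← hkx, Equiv.symm_apply_apply]
  have hOcoll : ∀ c, Coll I x c → Coll I y c → ∀ z ∈ O, Coll I z c := by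
    rintro c hxc hyc _ ⟨k, hk, rfl⟩
    obtain ⟨hk, hkc⟩ := sup_symmGroup_le_stabPt hxc hyc hk
    simpa only [hkc] using Coll.map hk hyc
  obtain ⟨k, hk, hkr⟩ := (mem_Pr_iff hr).1 hx
  obtain ⟨m, hm, hmr⟩ := (mem_Pr_iff hr).1 hy
  have hk1 : k ≠ 1 := by rintro rfl; exact hr.ne_one (by simpa using hkr.symm)
  have hm1 : m ≠ 1 := by rintro rfl; exact hr.ne_one (by simpa using hmr.symm)
  have hkfix : {z | z ∈ O ∧ k.1 z = z} = ∅ := by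
    refine Set.eq_empty_iff_forall_notMem.2 fun z ⟨hz, hkz⟩ => hk1 ?_
    refine h.symm_eq_one_s9 hs ht hk (hsep x z hxa hxb (hOcoll a hxa hya z hz)
      (hOcoll b hxb hyb z hz) ?_) hkz
    rintro rfl
    exact hxO hz
  have hmfix : {z | z ∈ O ∧ m.1 z = z} = {y} := by
    refine Set.Subset.antisymm (fun z ⟨hz, hmz⟩ => ?_) ?_
    · by_contra hzy
      exact hm1 (h.symm_eq_one_s9 hs ht hm (hsep y z hya hyb (hOcoll a hxa hya z hz)
        (hOcoll b hxb hyb z hz) (Ne.symm hzy)) hmz)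
    · rintro _ rfl
      exact ⟨hyO, hm.2 _ (let ⟨ℓ, hℓ⟩ := h.exists_line _; ⟨ℓ, hℓ, hℓ⟩)⟩
  have h₁ := ncard_modEq_ncard_fixed_s9 hr hkr (hOinv k (Subgroup.mem_sup_left hk))
  have h₂ := ncard_modEq_ncard_fixed_s9 hr hmr (hOinv m (Subgroup.mem_sup_right hm))
  rw [hkfix, Set.ncard_empty] at h₁
  rw [hmfix, Set.ncard_singleton] at h₂
  have h₃ := (Nat.modEq_zero_iff_dvd.1 (h₂.symm.trans h₁))
  exact hr.one_lt.not_ge (Nat.le_of_dvd one_pos h₃)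

theorem exists_bigGroup_apply_eq (h : IsGQ I s t) (hs : 2 ≤ s) (ht : 2 ≤ t)
    (hE : ∀ x : P, symmGroup I x ≠ ⊥) (hr : r.Prime) {x y : P}
    (hx : x ∈ Pr I r) (hy : y ∈ Pr I r) : ∃ k ∈ bigGroup I, k.1 x = y := by
  by_contra! hcon
  refine h.not_exists_invariant_coll_sets hs ht hE
    (X := {z | z ∈ Pr I r ∧ ∃ k ∈ bigGroup I, k.1 x = z})
    (Y := {z | z ∈ Pr I r ∧ ∀ k ∈ bigGroup I, k.1 x ≠ z})
    ⟨x, hx, 1, one_mem _, rfl⟩ ⟨y, hy, hcon⟩ ?_ ?_ ?_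
  · rintro w g hg _ ⟨hz, k, hk, rfl⟩
    exact ⟨apply_mem_Pr hr hg.1 hz, g * k, mul_mem (symmGroup_le_bigGroup I w hg) hk, rfl⟩
  · rintro w g hg z ⟨hz, hkz⟩
    refine ⟨apply_mem_Pr hr hg.1 hz, fun k hk hkx => ?_⟩
    refine hkz (g⁻¹ * k) (mul_mem (inv_mem (symmGroup_le_bigGroup I w hg)) hk) ?_
    change g.1.symm (k.1 x) = z
    rw [hkx, Equiv.symm_apply_apply]
  · rintro _ ⟨hz, k, hk, rfl⟩ z ⟨hz', hkz⟩
    by_contra hc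
    obtain ⟨m, hm, hmz⟩ := h.exists_sup_apply_eq hs ht hr hz hz' hc
    have hm' := sup_le (symmGroup_le_bigGroup I _) (symmGroup_le_bigGroup I _) hm
    exact hkz (m * k) (mul_mem hm' hk) hmz

/-- The stabilizer of a point `x` is transitive on the points of `P_r` collinear with and
different from `x`. -/
theorem exists_bigGroup_fixing_apply_eq (h : IsGQ I s t) (hs : 2 ≤ s) (ht : 2 ≤ t)
    (hE : ∀ x : P, symmGroup I x ≠ ⊥) (hr : r.Prime) {x y z : P}
    (hy : y ∈ Pr I r) (hz : z ∈ Pr I r) (hxy : Coll I x y) (hxz : Coll I x z)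
    (hyx : y ≠ x) (hzx : z ≠ x) : ∃ k ∈ bigGroup I, k.1 x = x ∧ k.1 y = z := by
  have hnoncoll : ∀ a b, a ∈ Pr I r → b ∈ Pr I r → Coll I x a → Coll I x b → ¬ Coll I a b →
      ∃ k ∈ bigGroup I, k.1 x = x ∧ k.1 a = b := by
    intro a b ha hb hxa hxb hab
    obtain ⟨k, hk, hkab⟩ := h.exists_sup_apply_eq hs ht hr ha hb hab
    exact ⟨k, sup_le (symmGroup_le_bigGroup I _) (symmGroup_le_bigGroup I _) hk,
      (sup_symmGroup_le_stabPt hxa.symm hxb.symm hk).2, hkab⟩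
  by_cases hyz : Coll I y z
  · obtain ⟨ℓ, hxℓ, hyℓ⟩ := hxy
    have hzℓ : I z ℓ := h.incid_of_coll hxℓ hyℓ hyx.symm hxz.symm hyz.symm
    obtain ⟨M, hxM, hMℓ⟩ := h.exists_line_ne ht x ℓ
    obtain ⟨w, hwM, hwx, -⟩ := h.exists_point_ne_ne hs M x x
    obtain ⟨g, hg, hg1⟩ := (Subgroup.bot_or_exists_ne_one _).resolve_left (hE w)
    have hgx := hg.2 x ⟨M, hwM, hxM⟩
    have hxgy : Coll I x (g.1 y) := by
      simpa only [hgx] using Coll.map hg.1 (⟨ℓ, hxℓ, hyℓ⟩ : Coll I x y)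
    have hgyℓ : ¬ I (g.1 y) ℓ := fun hgy =>
      have hgℓ := h.apply_line_eq hg.1 hyx.symm hxℓ hyℓ (by rwa [hgx]) hgy
      hMℓ (h.unique_line hwx hwM hxM (h.center_incid_of_fixed_line hs ht hg hg1 hgℓ) hxℓ)
    have hgy := apply_mem_Pr hr hg.1 hy
    have hsep : ∀ a, I a ℓ → a ≠ x → ¬ Coll I (g.1 y) a := fun a ha hax hc =>
      hgyℓ (h.incid_of_coll hxℓ ha hax.symm hxgy.symm hc)
    obtain ⟨k, hk, hkx, hky⟩ := hnoncoll y (g.1 y) hy hgy ⟨ℓ, hxℓ, hyℓ⟩ hxgy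
      fun hc => hsep y hyℓ hyx hc.symm
    obtain ⟨m, hm, hmx, hmz⟩ := hnoncoll (g.1 y) z hgy hz hxgy hxz (hsep z hzℓ hzx)
    refine ⟨m * k, mul_mem hm hk, ?_, ?_⟩
    · change m.1 (k.1 x) = x
      rw [hkx, hmx]
    · change m.1 (k.1 y) = z
      rw [hky, hmz]
  · exact hnoncoll y z hy hz hxy hxz hyz

/-- The group generated by the symmetries is transitive on the ordered pairs of distinct
collinear points of `P_r`. -/
theorem exists_bigGroup_apply_pair_eq (h : IsGQ I s t) (hs : 2 ≤ s) (ht : 2 ≤ t)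
    (hE : ∀ x : P, symmGroup I x ≠ ⊥) (hr : r.Prime) {x y x' y' : P}
    (hx : x ∈ Pr I r) (hy : y ∈ Pr I r) (hx' : x' ∈ Pr I r) (hy' : y' ∈ Pr I r)
    (hxy : Coll I x y) (hxy' : Coll I x' y') (hne : x ≠ y) (hne' : x' ≠ y') :
    ∃ k ∈ bigGroup I, k.1 x = x' ∧ k.1 y = y' := by
  obtain ⟨k, hk, rfl⟩ := h.exists_bigGroup_apply_eq hs ht hE hr hx hx'
  have hka := bigGroup_le_autGroup I hk
  obtain ⟨m, hm, hmx, hmy⟩ := h.exists_bigGroup_fixing_apply_eq hs ht hE hr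
    (apply_mem_Pr hr hka hy) hy' (Coll.map hka hxy) hxy' (k.1.injective.ne hne.symm) hne'.symm
  exact ⟨m * k, mul_mem hm hk, hmx, hmy⟩

end IsGQ

end Symmetries

/-- `G` is transitive on `P_r`; if moreover `L_r` is nonempty, then `G` is transitive on
`L_r` and, for each line `ℓ ∈ L_r`, the setwise stabilizer `G_ℓ` is `2`-transitive on the
set of points of `P_r` incident with `ℓ`. -/
theorem transitive_on_Pr_and_Lr {P L : Type} [Finite P] [Finite L]
    (I : P → L → Prop) (s t : ℕ) (hGQ : IsGQ I s t) (hs : 2 ≤ s) (ht : 2 ≤ t)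
    (hE : ∀ x : P, symmGroup I x ≠ ⊥) (r : ℕ) (hr : r.Prime) (hne : (Pr I r).Nonempty) :
    (∀ x ∈ Pr I r, ∀ y ∈ Pr I r, ∃ g ∈ bigGroup I, g.1 x = y) ∧
    ((Lr I r).Nonempty →
      (∀ ℓ ∈ Lr I r, ∀ m ∈ Lr I r, ∃ g ∈ bigGroup I, g.2 ℓ = m) ∧
      (∀ ℓ ∈ Lr I r, ∀ x y x' y' : P,
        x ∈ Pr I r → y ∈ Pr I r → x' ∈ Pr I r → y' ∈ Pr I r →
        I x ℓ → I y ℓ → I x' ℓ → I y' ℓ → x ≠ y → x' ≠ y' →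
        ∃ g ∈ bigGroup I, g.2 ℓ = ℓ ∧ g.1 x = x' ∧ g.1 y = y')) := by
  refine ⟨fun x hx y hy => hGQ.exists_bigGroup_apply_eq hs ht hE hr hx hy, fun _ => ⟨?_, ?_⟩⟩
  · rintro ℓ ⟨x, y, hne, hx, hy, hxℓ, hyℓ⟩ m ⟨x', y', hne', hx', hy', hxm, hym⟩
    obtain ⟨g, hg, rfl, rfl⟩ := hGQ.exists_bigGroup_apply_pair_eq hs ht hE hr hx hy hx' hy'
      ⟨ℓ, hxℓ, hyℓ⟩ ⟨m, hxm, hym⟩ hne hne'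
    exact ⟨g, hg, hGQ.apply_line_eq (bigGroup_le_autGroup I hg) hne hxℓ hyℓ hxm hym⟩
  · intro ℓ _ x y x' y' hx hy hx' hy' hxℓ hyℓ hxℓ' hyℓ' hne hne'
    obtain ⟨g, hg, rfl, rfl⟩ := hGQ.exists_bigGroup_apply_pair_eq hs ht hE hr hx hy hx' hy'
      ⟨ℓ, hxℓ, hyℓ⟩ ⟨ℓ, hxℓ', hyℓ'⟩ hne hne'
    exact ⟨g, hg, hGQ.apply_line_eq (bigGroup_le_autGroup I hg) hne hxℓ hyℓ hxℓ' hyℓ', rfl, rfl⟩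
end
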